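/- For the elephant random walk remembering only the most recent step, started at X_1 = 1: for every integer m ≥ 1, E((T_n/√n)^{2m}) → ((2m)!/(2^m m!))·(p/(1−p))^m and E((T_n/√n)^{2m−1}) → 0 as n → ∞; that is, all moments of T_n/√n converge to the corresponding moments of the N(0, p/(1−p)) distribution. -/

import Mathlib

open MeasureTheory ProbabilityTheory Filter Topology

noncomputable section

/-- The σ-algebra generated by the steps `X 1, …, X n`. -/
def sigmaUpTo {Ω : Type*} (X : ℕ → Ω → ℝ) (n : ℕ) : MeasurableSpace Ω :=
  ⨆ i ∈ Finset.Icc 1 n, MeasurableSpace.comap (X i) inferInstance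

/-- The σ-algebra generated by all the steps `X 1, X 2, …`. -/
def sigmaAll {Ω : Type*} (X : ℕ → Ω → ℝ) : MeasurableSpace Ω :=
  ⨆ i ∈ Set.Ici 1, MeasurableSpace.comap (X i) inferInstance

/-- The partial sum `X 1 + ⋯ + X n` of the walk. -/
def partialSum {Ω : Type*} (X : ℕ → Ω → ℝ) (n : ℕ) (ω : Ω) : ℝ :=
  ∑ k ∈ Finset.Icc 1 n, X k ω

/-- Convergence in distribution of the random variables `f n` to the law `ν`,
expressed as weak convergence tested against bounded continuous functions. -/
def TendstoInDistribution {Ω : Type*} [MeasurableSpace Ω] (μ : Measure Ω)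
    (f : ℕ → Ω → ℝ) (ν : Measure ℝ) : Prop :=
  ∀ g : BoundedContinuousFunction ℝ ℝ,
    Tendsto (fun n => ∫ ω, g (f n ω) ∂μ) atTop (𝓝 (∫ x, g x ∂ν))

/-- The moments of the centred normal law with variance `v`. -/
def gaussMoment (v : ℝ) : ℕ → ℝ
  | 0 => 1
  | 1 => 0
  | k + 2 => (k + 1) * v * gaussMoment v k

lemma gaussMoment_two_mul (v : ℝ) (m : ℕ) :
    gaussMoment v (2 * m) = ((2 * m).factorial : ℝ) / (2 ^ m * m.factorial) * v ^ m := by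
  induction m with
  | zero => simp [gaussMoment]
  | succ m ih =>
    rw [show 2 * (m + 1) = 2 * m + 2 by ring, gaussMoment, ih,
      Nat.factorial_succ, Nat.factorial_succ, Nat.factorial_succ m]
    have := Nat.factorial_pos m
    push_cast
    field_simp
    ring

lemma gaussMoment_two_mul_add_one (v : ℝ) (m : ℕ) : gaussMoment v (2 * m + 1) = 0 := by
  induction m with
  | zero => simp [gaussMoment]
  | succ m ih =>
    rw [show 2 * (m + 1) + 1 = 2 * m + 1 + 2 by ring, gaussMoment, ih, mul_zero]

lemma tendsto_sqrt_natCast_atTop : Tendsto (fun n : ℕ => √(n : ℝ)) atTop atTop :=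
  Real.tendsto_sqrt_atTop.comp tendsto_natCast_atTop_atTop

lemma tendsto_sqrt_pow_sub_div (m : ℕ) :
    Tendsto (fun n : ℕ => (√((n + 1 : ℕ) : ℝ) ^ (m + 2) - √(n : ℝ) ^ (m + 2)) / √(n : ℝ) ^ m)
      atTop (𝓝 (((m : ℝ) + 2) / 2)) := by
  have hd : HasDerivAt (fun x : ℝ => √x ^ (m + 2)) (((m : ℝ) + 2) / 2) 1 := by
    refine ((Real.hasDerivAt_sqrt one_ne_zero).fun_pow (m + 2)).congr_deriv ?_
    simp
    ring
  have h := hasDerivAt_iff_tendsto_slope_zero.1 hd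
  have hn : Tendsto (fun n : ℕ => (n : ℝ)⁻¹) atTop (𝓝[≠] 0) := by
    refine tendsto_nhdsWithin_iff.2 ⟨tendsto_inv_atTop_nhds_zero_nat, ?_⟩
    filter_upwards [eventually_gt_atTop 0] with n hn
    simp [hn.ne']
  refine (h.comp hn).congr' ?_
  filter_upwards [eventually_gt_atTop 0] with n hn
  have hn' : (0 : ℝ) < n := by exact_mod_cast hn
  have e : √((n + 1 : ℕ) : ℝ) = √(n : ℝ) * √(1 + (n : ℝ)⁻¹) := by
    rw [← Real.sqrt_mul hn'.le]
    congr 1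
    push_cast
    field_simp
  have hs : √(n : ℝ) ^ 2 = n := Real.sq_sqrt hn'.le
  have hs0 : √(n : ℝ) ≠ 0 := (Real.sqrt_pos.2 hn').ne'
  simp only [Function.comp, e, mul_pow, pow_add _ m 2, hs, inv_inv, smul_eq_mul, Real.sqrt_one,
    one_pow]
  field_simp

/-- A Stolz–Cesàro theorem for half-integer powers. -/
lemma tendsto_div_sqrt_pow_of_tendsto_sub (m : ℕ) (w : ℕ → ℝ) (L : ℝ)
    (h : Tendsto (fun n : ℕ => (w (n + 1) - w n) / √(n : ℝ) ^ m) atTop (𝓝 L)) :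
    Tendsto (fun n : ℕ => w n / √(n : ℝ) ^ (m + 2)) atTop (𝓝 (L / (((m : ℝ) + 2) / 2))) := by
  set c := L / (((m : ℝ) + 2) / 2) with hc
  set s : ℕ → ℝ := fun n => √(n : ℝ) ^ (m + 2) with hs
  have hs_atTop : Tendsto s atTop atTop :=
    (tendsto_pow_atTop (α := ℝ) (by omega)).comp tendsto_sqrt_natCast_atTop
  have hgpos : ∀ n, 0 < s (n + 1) - s n := by
    intro n
    have : s n < s (n + 1) := by
      simp only [hs]
      gcongr
      all_goals simp
    linarith
  have hg := tendsto_sqrt_pow_sub_div m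
  have hsum : ∀ n, ∑ i ∈ Finset.range n, (s (i + 1) - s i) = s n := by
    intro n
    rw [Finset.sum_range_sub]
    simp [hs]
  have hf : (fun n => (w (n + 1) - w n) - c * (s (n + 1) - s n)) =o[atTop]
      fun n => s (n + 1) - s n := by
    refine Asymptotics.isLittleO_of_tendsto' (.of_forall fun n hn => absurd hn (hgpos n).ne') ?_
    have hm : ((m : ℝ) + 2) / 2 ≠ 0 := by positivity
    have h3 := (h.div hg hm).sub_const c
    rw [← hc, sub_self] at h3
    refine h3.congr' ?_
    filter_upwards [eventually_gt_atTop 0] with n hn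
    have hn' : √(n : ℝ) ≠ 0 := (Real.sqrt_pos.2 (by exact_mod_cast hn)).ne'
    have := (hgpos n).ne'
    simp only [Pi.div_apply]
    change _ / ((s (n + 1) - s n) / _) - c = _
    field_simp
  have ho := hf.sum_range (fun n => (hgpos n).le) (by simpa only [hsum] using hs_atTop)
  simp only [hsum, Finset.sum_sub_distrib, ← Finset.mul_sum] at ho
  have h4 := ho.tendsto_div_nhds_zero
  have h5 : Tendsto (fun n => w 0 / s n) atTop (𝓝 0) := tendsto_const_nhds.div_atTop hs_atTop
  have h6 := (h4.add h5).add_const c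
  simp only [zero_add] at h6
  refine h6.congr' ?_
  filter_upwards [eventually_gt_atTop 0] with n hn
  have hn' : s n ≠ 0 := (pow_pos (Real.sqrt_pos.2 (by exact_mod_cast hn)) _).ne'
  have e2 : ∑ i ∈ Finset.range n, w (i + 1) - ∑ i ∈ Finset.range n, w i = w n - w 0 := by
    rw [← Finset.sum_sub_distrib, Finset.sum_range_sub]
  change _ = w n / s n
  simp only [e2]
  field_simp
  ring

lemma abs_pow_le_one_add_pow {i e : ℕ} (hie : i ≤ e) (he : Even e) (x : ℝ) :
    |x| ^ i ≤ 1 + x ^ e := by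
  have h0 : 0 ≤ x ^ e := he.pow_nonneg x
  rcases le_total |x| 1 with h | h
  · have := pow_le_one₀ (n := i) (abs_nonneg x) h
    linarith
  · have h1 := pow_le_pow_right₀ h hie
    rw [he.pow_abs] at h1
    linarith

section Moments

variable {Ω : Type*} [MeasurableSpace Ω] {μ : Measure Ω} [IsProbabilityMeasure μ]

lemma integrable_pow_mul_pow {f g : Ω → ℝ} (hf : Measurable f) (hg : Measurable g)
    (hfb : ∃ B, ∀ᵐ ω ∂μ, |f ω| ≤ B) (hgb : ∃ B, ∀ᵐ ω ∂μ, |g ω| ≤ B) (i j : ℕ) :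
    Integrable (fun ω => f ω ^ i * g ω ^ j) μ := by
  obtain ⟨B, hB⟩ := hfb
  obtain ⟨C, hC⟩ := hgb
  refine Integrable.of_bound (by fun_prop) (B ^ i * C ^ j) ?_
  filter_upwards [hB, hC] with ω h1 h2
  rw [Real.norm_eq_abs, abs_mul, abs_pow, abs_pow]
  gcongr
  exact pow_nonneg ((abs_nonneg _).trans h1) _

lemma integrable_pow_of_bounded {f : Ω → ℝ} (hf : Measurable f)
    (hfb : ∃ B, ∀ᵐ ω ∂μ, |f ω| ≤ B) (i : ℕ) : Integrable (fun ω => f ω ^ i) μ := by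
  simpa using integrable_pow_mul_pow hf hf hfb hfb i 0

/-- If the normalised moments of `M n / √n` up to order `m` converge, then mixed moments with a
bounded sequence are negligible at scale `√n ^ m` as soon as the power of `M n` is below `m`. -/
lemma tendsto_integral_pow_mul_pow_div {M Y : ℕ → Ω → ℝ} (hM : ∀ n, Measurable (M n))
    (hMb : ∀ n, ∃ B, ∀ᵐ ω ∂μ, |M n ω| ≤ B) {C : ℝ}
    (hY : ∀ n, 1 ≤ n → ∀ᵐ ω ∂μ, |Y n ω| ≤ C) {m : ℕ}
    (hlim : ∀ k ≤ m, ∃ l, Tendsto (fun n : ℕ => (∫ ω, M n ω ^ k ∂μ) / √(n : ℝ) ^ k) atTop (𝓝 l))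
    {i : ℕ} (hi : i < m) (j : ℕ) :
    Tendsto (fun n : ℕ => (∫ ω, M n ω ^ i * Y n ω ^ j ∂μ) / √(n : ℝ) ^ m) atTop (𝓝 0) := by
  obtain ⟨e, hie, hem, he⟩ : ∃ e, i ≤ e ∧ e ≤ m ∧ Even e := by
    rcases Nat.even_or_odd i with h | h
    · exact ⟨i, le_rfl, hi.le, h⟩
    · exact ⟨i + 1, by omega, hi, h.add_one⟩
  obtain ⟨l, hl⟩ := hlim e hem
  have hz : Tendsto (fun n : ℕ => C ^ j * (1 + (∫ ω, M n ω ^ e ∂μ) / √(n : ℝ) ^ e) /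
      √(n : ℝ) ^ (m - i)) atTop (𝓝 0) :=
    ((hl.const_add 1).const_mul (C ^ j)).div_atTop
      ((tendsto_pow_atTop (α := ℝ) (by omega)).comp tendsto_sqrt_natCast_atTop)
  refine squeeze_zero_norm' ?_ hz
  filter_upwards [eventually_ge_atTop 1] with n hn
  have hs : 0 < √(n : ℝ) := Real.sqrt_pos.2 (by exact_mod_cast hn)
  have h_integrable : Integrable (fun ω => C ^ j * (√(n : ℝ) ^ i * (1 + M n ω ^ e / √(n : ℝ) ^ e))) μ :=
    (((integrable_const _).add
      ((integrable_pow_of_bounded (hM n) (hMb n) e).div_const _)).const_mul _).const_mul _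
  have hbound : ‖∫ ω, M n ω ^ i * Y n ω ^ j ∂μ‖ ≤
      ∫ ω, C ^ j * (√(n : ℝ) ^ i * (1 + M n ω ^ e / √(n : ℝ) ^ e)) ∂μ := by
    refine norm_integral_le_of_norm_le h_integrable ?_
    filter_upwards [hY n hn] with ω hω
    have h1 := abs_pow_le_one_add_pow hie he (M n ω / √(n : ℝ))
    rw [abs_div, abs_of_pos hs, div_pow, div_pow, div_le_iff₀ (by positivity)] at h1
    rw [Real.norm_eq_abs, abs_mul, abs_pow, abs_pow, mul_comm]
    have hC : 0 ≤ C := (abs_nonneg _).trans hω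
    rw [mul_comm (√(n : ℝ) ^ i)]
    gcongr
  rw [norm_div, norm_pow, Real.norm_of_nonneg hs.le, div_le_iff₀ (by positivity)]
  refine hbound.trans (le_of_eq ?_)
  rw [integral_const_mul, integral_const_mul, integral_add (integrable_const _)
    ((integrable_pow_of_bounded (hM n) (hMb n) e).div_const _), integral_div]
  have : √(n : ℝ) ^ m = √(n : ℝ) ^ (m - i) * √(n : ℝ) ^ i := by
    rw [← pow_add]
    congr 1
    omega
  rw [this]
  simp
  field_simp

/-- The moment method for martingale-like sequences with bounded increments whose conditional
variance is the constant `v`. -/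
lemma tendsto_moment_of_increments {M : ℕ → Ω → ℝ} (hM : ∀ n, Measurable (M n))
    (hMb : ∀ n, ∃ B, ∀ᵐ ω ∂μ, |M n ω| ≤ B) {C v : ℝ}
    (hD : ∀ n, 1 ≤ n → ∀ᵐ ω ∂μ, |M (n + 1) ω - M n ω| ≤ C)
    (hD1 : ∀ n, 1 ≤ n → ∀ i, ∫ ω, M n ω ^ i * (M (n + 1) ω - M n ω) ∂μ = 0)
    (hD2 : ∀ n, 1 ≤ n → ∀ i,
      ∫ ω, M n ω ^ i * (M (n + 1) ω - M n ω) ^ 2 ∂μ = v * ∫ ω, M n ω ^ i ∂μ) (k : ℕ) :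
    Tendsto (fun n : ℕ => (∫ ω, M n ω ^ k ∂μ) / √(n : ℝ) ^ k) atTop (𝓝 (gaussMoment v k)) := by
  induction k using Nat.strong_induction_on with
  | _ k ih =>
  match k with
  | 0 => simp [gaussMoment]
  | 1 =>
    have hconst : ∀ n, ∫ ω, M (n + 1) ω ∂μ = ∫ ω, M 1 ω ∂μ := by
      intro n
      induction n with
      | zero => simp
      | succ n ihn =>
        have h := hD1 (n + 1) (by omega) 0
        simp only [pow_zero, one_mul] at h
        rw [integral_sub] at h
        · linarith
        · simpa using integrable_pow_of_bounded (hM (n + 1 + 1)) (hMb _) 1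
        · simpa using integrable_pow_of_bounded (hM (n + 1)) (hMb _) 1
    have h := tendsto_sqrt_natCast_atTop.const_div_atTop (∫ ω, M 1 ω ∂μ)
    refine h.congr' ?_
    filter_upwards [eventually_ge_atTop 1] with n hn
    obtain ⟨n, rfl⟩ := Nat.exists_eq_add_of_le' hn
    simp [hconst n]
  | m + 2 =>
    have hrem := fun i (hi : i < m) => tendsto_integral_pow_mul_pow_div (μ := μ) hM hMb
      (Y := fun n ω => M (n + 1) ω - M n ω) hD
      (fun k hk => ⟨_, ih k (by omega)⟩) hi (m + 2 - i)
    have hsum := tendsto_finsetSum (Finset.range m) fun i hi =>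
      (hrem i (Finset.mem_range.1 hi)).mul_const ((m + 2).choose i : ℝ)
    have hmain := (ih m (by omega)).const_mul (((m + 2).choose m : ℝ) * v)
    have htot := hsum.add hmain
    have hstep := tendsto_div_sqrt_pow_of_tendsto_sub m (fun n => ∫ ω, M n ω ^ (m + 2) ∂μ) _
      (htot.congr' ?_)
    · convert hstep using 2
      have hch : ((m + 2).choose m : ℝ) = (m + 2) * (m + 1) / 2 := by
        rw [Nat.choose_symm_add, Nat.cast_choose_two]
        push_cast
        ring
      have : (m : ℝ) + 2 ≠ 0 := by positivity
      rw [hch, gaussMoment]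
      simp
      field_simp
    · filter_upwards [eventually_ge_atTop 1] with n hn
      have hDm : Measurable fun ω => M (n + 1) ω - M n ω := (hM _).sub (hM _)
      have hI := fun i j => integrable_pow_mul_pow (hM n) hDm (hMb n) ⟨C, hD n hn⟩ i j
      have hexp : ∀ ω, M (n + 1) ω ^ (m + 2) =
          ∑ i ∈ Finset.range m, M n ω ^ i * (M (n + 1) ω - M n ω) ^ (m + 2 - i) *
            ((m + 2).choose i : ℝ) +
          M n ω ^ m * (M (n + 1) ω - M n ω) ^ 2 * ((m + 2).choose m : ℝ) +
          M n ω ^ (m + 1) * (M (n + 1) ω - M n ω) ^ 1 * ((m + 2).choose (m + 1) : ℝ) +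
          M n ω ^ (m + 2) := by
        intro ω
        have h := add_pow (M n ω) (M (n + 1) ω - M n ω) (m + 2)
        rw [add_sub_cancel, Finset.sum_range_succ, Finset.sum_range_succ,
          Finset.sum_range_succ] at h
        rw [h]
        simp
      have hE : ∫ ω, M (n + 1) ω ^ (m + 2) ∂μ =
          ∑ i ∈ Finset.range m, (∫ ω, M n ω ^ i * (M (n + 1) ω - M n ω) ^ (m + 2 - i) ∂μ) *
            ((m + 2).choose i : ℝ) +
          v * (∫ ω, M n ω ^ m ∂μ) * ((m + 2).choose m : ℝ) + ∫ ω, M n ω ^ (m + 2) ∂μ := by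
        have i1 : Integrable (fun ω => ∑ i ∈ Finset.range m,
            M n ω ^ i * (M (n + 1) ω - M n ω) ^ (m + 2 - i) * ((m + 2).choose i : ℝ)) μ :=
          integrable_finsetSum _ fun i _ => (hI _ _).mul_const _
        have i2 := (hI m 2).mul_const ((m + 2).choose m : ℝ)
        have i3 := (hI (m + 1) 1).mul_const ((m + 2).choose (m + 1) : ℝ)
        have i4 := integrable_pow_of_bounded (hM n) (hMb n) (m + 2)
        have h3 := hD1 n hn (m + 1)
        simp_rw [hexp]
        rw [integral_add ((i1.fun_add i2).fun_add i3) i4, integral_add (i1.fun_add i2) i3,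
          integral_add i1 i2, integral_finsetSum _ fun i _ => (hI _ _).mul_const _]
        simp only [integral_mul_const, pow_one, h3, hD2 n hn]
        ring
      rw [hE]
      simp only [add_sub_cancel_right, add_div, Finset.sum_div]
      congr 1
      · exact Finset.sum_congr rfl fun i _ => by ring
      · ring

lemma tendsto_moment_add_bounded {M Y : ℕ → Ω → ℝ} (hM : ∀ n, Measurable (M n))
    (hYm : ∀ n, Measurable (Y n)) (hMb : ∀ n, ∃ B, ∀ᵐ ω ∂μ, |M n ω| ≤ B) {C : ℝ}
    (hY : ∀ n, 1 ≤ n → ∀ᵐ ω ∂μ, |Y n ω| ≤ C) {l : ℕ → ℝ}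
    (hlim : ∀ k, Tendsto (fun n : ℕ => (∫ ω, M n ω ^ k ∂μ) / √(n : ℝ) ^ k) atTop (𝓝 (l k)))
    (k : ℕ) :
    Tendsto (fun n : ℕ => (∫ ω, (M n ω + Y n ω) ^ k ∂μ) / √(n : ℝ) ^ k) atTop (𝓝 (l k)) := by
  have hsum := tendsto_finsetSum (Finset.range k) fun i hi =>
    (tendsto_integral_pow_mul_pow_div (μ := μ) hM hMb hY (m := k) (fun k _ => ⟨_, hlim k⟩)
      (Finset.mem_range.1 hi) (k - i)).mul_const (k.choose i : ℝ)
  have htot := hsum.add (hlim k)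
  simp only [zero_mul, Finset.sum_const_zero, zero_add] at htot
  refine htot.congr' ?_
  filter_upwards [eventually_ge_atTop 1] with n hn
  have hI := fun i j => integrable_pow_mul_pow (hM n) (hYm n) (hMb n) ⟨C, hY n hn⟩ i j
  simp_rw [add_pow, Finset.sum_range_succ]
  rw [integral_add (integrable_finsetSum _ fun i _ => (hI _ _).mul_const _)
    ((hI _ _).mul_const _), integral_finsetSum _ fun i _ => (hI _ _).mul_const _]
  simp only [integral_mul_const, Nat.sub_self, pow_zero, mul_one, Nat.choose_self, Nat.cast_one,
    add_div, Finset.sum_div]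
  congr 1
  exact Finset.sum_congr rfl fun i _ => by ring

end Moments

section Walk

variable {Ω : Type*}

lemma sigmaUpTo_le {mΩ : MeasurableSpace Ω} {X : ℕ → Ω → ℝ} (hX : ∀ i, Measurable (X i)) (n : ℕ) :
    sigmaUpTo X n ≤ mΩ :=
  iSup₂_le fun i _ => (hX i).comap_le

lemma measurable_sigmaUpTo (X : ℕ → Ω → ℝ) {i n : ℕ} (hi : i ∈ Finset.Icc 1 n) :
    Measurable[sigmaUpTo X n] (X i) :=
  (comap_measurable (X i)).mono
    (le_iSup₂ (f := fun i (_ : i ∈ Finset.Icc 1 n) =>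
      MeasurableSpace.comap (X i) inferInstance) i hi) le_rfl

lemma measurable_partialSum_sigmaUpTo (X : ℕ → Ω → ℝ) (n : ℕ) :
    Measurable[sigmaUpTo X n] (partialSum X n) := by
  unfold partialSum
  exact Finset.measurable_fun_sum _ fun i hi => measurable_sigmaUpTo X hi

lemma integral_mul_of_condExp_eq {m mΩ : MeasurableSpace Ω} {μ : Measure Ω} [IsFiniteMeasure μ]
    (hm : m ≤ mΩ)
    {f Y Z : Ω → ℝ} (hf : Measurable[m] f) (hfb : ∃ B, ∀ᵐ ω ∂μ, |f ω| ≤ B)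
    (hY : Integrable Y μ) (h : μ[Y | m] =ᵐ[μ] Z) :
    ∫ ω, f ω * Y ω ∂μ = ∫ ω, f ω * Z ω ∂μ := by
  obtain ⟨B, hB⟩ := hfb
  have h1 := condExp_stronglyMeasurable_mul_of_bound hm hf.stronglyMeasurable hY B
    (by simpa only [Real.norm_eq_abs] using hB)
  calc ∫ ω, f ω * Y ω ∂μ = ∫ ω, (μ[f * Y | m]) ω ∂μ := (integral_condExp hm).symm
    _ = ∫ ω, f ω * Z ω ∂μ := by
      refine integral_congr_ae ?_
      filter_upwards [h1, h] with ω h1 h2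
      rw [h1, Pi.mul_apply, h2]

lemma abs_partialSum_le {mΩ : MeasurableSpace Ω} {μ : Measure Ω} {X : ℕ → Ω → ℝ}
    (hX : ∀ i, 1 ≤ i → ∀ᵐ ω ∂μ, |X i ω| ≤ 1) (n : ℕ) :
    ∀ᵐ ω ∂μ, |partialSum X n ω| ≤ n := by
  have h : ∀ᵐ ω ∂μ, ∀ i, 1 ≤ i → |X i ω| ≤ 1 := by
    rw [ae_all_iff]
    intro i
    by_cases hi : 1 ≤ i
    · simpa [hi] using hX i hi
    · simp [hi]
  filter_upwards [h] with ω hω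
  calc |partialSum X n ω| ≤ ∑ k ∈ Finset.Icc 1 n, |X k ω| := Finset.abs_sum_le_sum_abs _ _
    _ ≤ ∑ k ∈ Finset.Icc 1 n, (1 : ℝ) :=
      Finset.sum_le_sum fun k hk => hω k (Finset.mem_Icc.1 hk).1
    _ = n := by simp

/-- The moments of `partialSum X n / √n` converge to those of the centred normal law with variance
`(1 + a) / (1 - a)` when the steps are signs with `E[X (n + 1) | X 1, …, X n] = a * X n`. -/
lemma tendsto_moment_partialSum {mΩ : MeasurableSpace Ω} {μ : Measure Ω}
    [IsProbabilityMeasure μ] {a : ℝ} (ha : a < 1) {X : ℕ → Ω → ℝ} (hX : ∀ i, Measurable (X i))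
    (hval : ∀ i, 1 ≤ i → ∀ᵐ ω ∂μ, X i ω = 1 ∨ X i ω = -1)
    (hcond : ∀ n, 1 ≤ n → μ[X (n + 1) | sigmaUpTo X n] =ᵐ[μ] fun ω => a * X n ω) (k : ℕ) :
    Tendsto (fun n : ℕ => ∫ ω, (partialSum X n ω / √(n : ℝ)) ^ k ∂μ) atTop
      (𝓝 (gaussMoment ((1 + a) / (1 - a)) k)) := by
  have ha' : 1 - a ≠ 0 := (sub_pos.2 ha).ne'
  have hXb : ∀ i, 1 ≤ i → ∀ᵐ ω ∂μ, |X i ω| ≤ 1 := fun i hi => by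
    filter_upwards [hval i hi] with ω hω
    rcases hω with h | h <;> simp [h]
  set c := a / (1 - a) with hc
  -- the index `0` is irrelevant, and `X 0` need not be bounded
  set Y : ℕ → Ω → ℝ := fun n ω => if n = 0 then 0 else c * X n ω with hYdef
  have hYm : ∀ n, Measurable (Y n) := fun n => by
    by_cases hn : n = 0
    · simp [hYdef, hn]
    · simpa [hYdef, hn] using (hX n).const_mul c
  have hYb : ∀ n, ∀ᵐ ω ∂μ, |Y n ω| ≤ |c| := fun n => by
    by_cases hn : n = 0
    · simp [hYdef, hn]
    · filter_upwards [hXb n (by omega)] with ω hω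
      simpa [hYdef, hn, abs_mul] using mul_le_mul_of_nonneg_left hω (abs_nonneg c)
  set M : ℕ → Ω → ℝ := fun n ω => partialSum X n ω + Y n ω with hMdef
  have hTm : ∀ n, Measurable (partialSum X n) := fun n =>
    (measurable_partialSum_sigmaUpTo X n).mono (sigmaUpTo_le hX n) le_rfl
  have hMm : ∀ n, Measurable (M n) := fun n => (hTm n).add (hYm n)
  have hMb : ∀ n, ∃ B, ∀ᵐ ω ∂μ, |M n ω| ≤ B := fun n => ⟨n + |c|, by
    filter_upwards [abs_partialSum_le hXb n, hYb n] with ω h1 h2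
    exact (abs_add_le _ _).trans (add_le_add h1 h2)⟩
  have hMs : ∀ n, 1 ≤ n → Measurable[sigmaUpTo X n] (M n) := fun n hn => by
    have h1 := measurable_partialSum_sigmaUpTo X n
    have h2 := (measurable_sigmaUpTo X (Finset.mem_Icc.2 ⟨hn, le_refl n⟩)).const_mul c
    simpa only [hMdef, hYdef, (show n ≠ 0 by omega), if_false] using h1.fun_add h2
  have hincr : ∀ n, 1 ≤ n → ∀ ω, M (n + 1) ω - M n ω = (X (n + 1) ω - a * X n ω) / (1 - a) := by
    intro n hn ω
    simp only [hMdef, hYdef, (show n ≠ 0 by omega), if_false, partialSum,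
      Finset.sum_Icc_succ_top (show 1 ≤ n + 1 by omega), Nat.succ_ne_zero, hc]
    field_simp
    ring
  have hXint : ∀ n, 1 ≤ n → Integrable (X n) μ := fun n hn => by
    simpa using integrable_pow_of_bounded (hX n) ⟨1, hXb n hn⟩ 1
  have hMX : ∀ n, 1 ≤ n → ∀ i, ∫ ω, M n ω ^ i * X (n + 1) ω ∂μ =
      a * ∫ ω, M n ω ^ i * X n ω ∂μ := by
    intro n hn i
    obtain ⟨B, hB⟩ := hMb n
    rw [integral_mul_of_condExp_eq (sigmaUpTo_le hX n) ((hMs n hn).pow_const i) ⟨B ^ i, ?_⟩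
      (hXint _ (by omega)) (hcond n hn), ← integral_const_mul]
    · congr 1 with ω
      ring
    · filter_upwards [hB] with ω hω
      rw [abs_pow]
      gcongr
  have hMXX : ∀ n, 1 ≤ n → ∀ i, ∫ ω, M n ω ^ i * X n ω * X (n + 1) ω ∂μ =
      a * ∫ ω, M n ω ^ i ∂μ := by
    intro n hn i
    obtain ⟨B, hB⟩ := hMb n
    rw [integral_mul_of_condExp_eq (sigmaUpTo_le hX n)
      (((hMs n hn).pow_const i).fun_mul (measurable_sigmaUpTo X (Finset.mem_Icc.2 ⟨hn, le_refl n⟩)))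
      ⟨B ^ i * 1, ?_⟩ (hXint _ (by omega)) (hcond n hn), ← integral_const_mul]
    · refine integral_congr_ae ?_
      filter_upwards [hval n hn] with ω hω
      rcases hω with h | h <;> simp [h] <;> ring
    · filter_upwards [hB, hXb n hn] with ω h1 h2
      rw [abs_mul, abs_pow]
      gcongr
      exact pow_nonneg ((abs_nonneg _).trans h1) _
  have hM : ∀ k, Tendsto (fun n : ℕ => (∫ ω, M n ω ^ k ∂μ) / √(n : ℝ) ^ k) atTop
      (𝓝 (gaussMoment ((1 + a) / (1 - a)) k)) := by
    refine tendsto_moment_of_increments hMm hMb (C := (1 + |a|) / (1 - a)) ?_ ?_ ?_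
    · intro n hn
      filter_upwards [hXb n hn, hXb (n + 1) (by omega)] with ω h1 h2
      rw [hincr n hn, abs_div, abs_of_pos (sub_pos.2 ha)]
      have h3 : |X (n + 1) ω - a * X n ω| ≤ 1 + |a| := by
        refine (abs_sub _ _).trans (add_le_add h2 ?_)
        rw [abs_mul]
        exact mul_le_of_le_one_right (abs_nonneg a) h1
      have := sub_pos.2 ha
      gcongr
    · intro n hn i
      have i1 := integrable_pow_mul_pow (hMm n) (hX (n + 1)) (hMb n) ⟨1, hXb _ (by omega)⟩ i 1
      have i2 := integrable_pow_mul_pow (hMm n) (hX n) (hMb n) ⟨1, hXb _ hn⟩ i 1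
      simp only [pow_one] at i1 i2
      have e : ∀ ω, M n ω ^ i * (M (n + 1) ω - M n ω) =
          (M n ω ^ i * X (n + 1) ω - a * (M n ω ^ i * X n ω)) / (1 - a) := fun ω => by
        rw [hincr n hn]
        ring
      simp_rw [e]
      rw [integral_div, integral_sub i1 (i2.const_mul a), integral_const_mul, hMX n hn, sub_self,
        zero_div]
    · intro n hn i
      have i1 := integrable_pow_of_bounded (hMm n) (hMb n) i
      have i2 : Integrable (fun ω => M n ω ^ i * X n ω * X (n + 1) ω) μ := by
        have h := integrable_pow_mul_pow (hMm n) ((hX n).mul (hX (n + 1))) (hMb n) ⟨1, ?_⟩ i 1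
        · simpa [mul_assoc] using h
        · filter_upwards [hXb n hn, hXb (n + 1) (by omega)] with ω h1 h2
          rw [Pi.mul_apply, abs_mul]
          exact mul_le_one₀ h1 (abs_nonneg _) h2
      have e : ∀ᵐ ω ∂μ, M n ω ^ i * (M (n + 1) ω - M n ω) ^ 2 =
          ((1 + a ^ 2) * M n ω ^ i - 2 * a * (M n ω ^ i * X n ω * X (n + 1) ω)) / (1 - a) ^ 2 := by
        filter_upwards [hval n hn, hval (n + 1) (by omega)] with ω h1 h2
        rw [hincr n hn, div_pow, ← mul_div_assoc]
        congr 1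
        rcases h1 with h1 | h1 <;> rcases h2 with h2 | h2 <;> rw [h1, h2] <;> ring
      rw [integral_congr_ae e, integral_div, integral_sub (i1.const_mul _) (i2.const_mul _),
        integral_const_mul, integral_const_mul, hMXX n hn]
      field_simp
      ring
  have hfin := tendsto_moment_add_bounded (Y := fun n ω => -Y n ω) hMm (fun n => (hYm n).neg) hMb
    (C := |c|) (fun n _ => by simpa only [abs_neg] using hYb n) hM k
  refine hfin.congr fun n => ?_
  simp_rw [div_pow, integral_div, hMdef, add_neg_cancel_right]

end Walk

/-- for the elephant random walk remembering only the most recent step,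
started at `X₁ = 1`: for every `m ≥ 1`, `E((Tₙ/√n)^(2m)) → ((2m)!/(2^m m!))·(p/(1-p))^m`
and `E((Tₙ/√n)^(2m-1)) → 0`, i.e. all moments of `Tₙ/√n` converge to those of
`N(0, p/(1-p))`. -/
theorem elephant_last_step_moments
    {Ω : Type*} [MeasurableSpace Ω] (μ : Measure Ω) [IsProbabilityMeasure μ]
    (p : ℝ) (hp0 : 0 < p) (hp1 : p < 1)
    (X : ℕ → Ω → ℝ)
    (hXmeas : ∀ i, Measurable (X i))
    (hval : ∀ i, 1 ≤ i → ∀ᵐ ω ∂μ, X i ω = 1 ∨ X i ω = -1)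
    (hinit : ∀ᵐ ω ∂μ, X 1 ω = 1)
    (hcond : ∀ n, 1 ≤ n →
      μ[X (n+1) | sigmaUpTo X n] =ᵐ[μ] fun ω => (2*p-1) * X n ω) :
    ∀ m : ℕ, 1 ≤ m →
      Tendsto (fun n : ℕ => ∫ ω, (partialSum X n ω / Real.sqrt n)^(2*m) ∂μ) atTop
        (𝓝 (((Nat.factorial (2*m) : ℝ) / (2^m * Nat.factorial m)) * (p/(1-p))^m)) ∧
      Tendsto (fun n : ℕ => ∫ ω, (partialSum X n ω / Real.sqrt n)^(2*m-1) ∂μ) atTop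
        (𝓝 0) := by
  intro m hm
  have h := tendsto_moment_partialSum (a := 2 * p - 1) (by linarith) hXmeas hval hcond
  have hv : (1 + (2 * p - 1)) / (1 - (2 * p - 1)) = p / (1 - p) := by
    have : 1 - p ≠ 0 := (sub_pos.2 hp1).ne'
    rw [show 1 + (2 * p - 1) = 2 * p by ring, show 1 - (2 * p - 1) = 2 * (1 - p) by ring,
      mul_div_mul_left _ _ two_ne_zero]
  rw [hv] at h
  refine ⟨gaussMoment_two_mul (p / (1 - p)) m ▸ h (2 * m), ?_⟩
  obtain ⟨m, rfl⟩ := Nat.exists_eq_add_of_le' hm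
  have h' := h (2 * m + 1)
  rwa [gaussMoment_two_mul_add_one] at h'
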